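/- Let x ~ N(0, K) with K positive definite having distinct eigenvalues, and ε a vector of i.i.d. Uniform[−1/2,1/2] components independent of x. Any d×d matrix W achieving the infimum of tr(K) − tr(KW(WᵀKW + I/12)⁻¹WᵀK) + λ·Σᵢ h(wᵢᵀx + εᵢ) (λ > 0, h differential entropy, wᵢ the i-th column of W) has all of its nonzero columns equal to (scalar multiples of) eigenvectors of K. -/

import Mathlib

open Matrix MeasureTheory ProbabilityTheory

/-- The density of `√s·Z + ε`, `Z` standard Gaussian, `ε ~ Uniform[−1/2,1/2]` independent:
the convolution of the `N(0, s)` density with the uniform density. Since `x ~ N(0, K)`, the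
latent `wᵢᵀx + εᵢ` has exactly this density with `s = wᵢᵀKwᵢ`. -/
noncomputable def ditherGaussDensity (s : ℝ) (x : ℝ) : ℝ :=
  ∫ u in Set.Icc (-(1 / 2) : ℝ) (1 / 2), gaussianPDFReal 0 (Real.toNNReal s) (x - u)

/-- The differential entropy `h(wᵢᵀx + εᵢ)` expressed through the latent variance
`s = wᵢᵀKwᵢ`. -/
noncomputable def ditherGaussEntropy (s : ℝ) : ℝ :=
  -∫ x : ℝ, ditherGaussDensity s x * Real.log (ditherGaussDensity s x)

open scoped ENNReal NNReal

namespace NTC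

noncomputable def U : Measure ℝ := volume.restrict (Set.Icc (-(1 / 2) : ℝ) (1 / 2))

instance : IsProbabilityMeasure U := ⟨by simp [U]; norm_num⟩

noncomputable def gam (t : ℝ) : Measure ℝ := gaussianReal 0 t.toNNReal

instance (t : ℝ) : IsProbabilityMeasure (gam t) := by unfold gam; infer_instance

noncomputable def mu (s : ℝ) : Measure ℝ := U ∗ gam s

instance (t : ℝ) : IsProbabilityMeasure (mu t) := by unfold mu; infer_instance

lemma conv_withDensity (ν : Measure ℝ) [SFinite ν] (f : ℝ → ℝ≥0∞) (hf : Measurable f) :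
    ν ∗ (volume.withDensity f) = volume.withDensity (fun x => ∫⁻ u, f (x - u) ∂ν) := by
  have hmeas : Measurable (fun x => ∫⁻ u, f (x - u) ∂ν) := by
    apply Measurable.lintegral_prod_right' (f := fun p : ℝ × ℝ => f (p.1 - p.2))
    fun_prop
  refine Measure.ext_of_lintegral _ fun g hg => ?_
  rw [Measure.lintegral_conv hg, lintegral_withDensity_eq_lintegral_mul _ hmeas hg]
  have h1 : ∀ u, ∫⁻ z, g (u + z) ∂(volume.withDensity f) = ∫⁻ x, f (x - u) * g x := by
    intro u
    rw [lintegral_withDensity_eq_lintegral_mul _ hf (by fun_prop)]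
    rw [← lintegral_sub_right_eq_self _ u]
    simp
  simp_rw [h1]
  rw [lintegral_lintegral_swap (by fun_prop)]
  refine lintegral_congr fun x => ?_
  simp only [Pi.mul_apply]
  rw [lintegral_mul_const _ (by fun_prop)]

lemma toNN_ne {s : ℝ} (hs : 0 < s) : s.toNNReal ≠ 0 := by simpa using hs

lemma gpdf_cont (v : ℝ≥0) : Continuous (gaussianPDFReal 0 v) := by
  rw [gaussianPDFReal_def]; fun_prop

lemma mu_eq {s : ℝ} (hs : 0 < s) :
    mu s = volume.withDensity (fun x => ENNReal.ofReal (ditherGaussDensity s x)) := by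
  unfold mu gam
  rw [gaussianReal_of_var_ne_zero _ (toNN_ne hs), conv_withDensity _ _ (measurable_gaussianPDF _ _)]
  congr 1
  ext x
  unfold ditherGaussDensity gaussianPDF U
  rw [ofReal_integral_eq_lintegral_ofReal]
  · apply Continuous.integrableOn_Icc
    exact (gpdf_cont _).comp (by fun_prop)
  · exact Filter.Eventually.of_forall fun u => gaussianPDFReal_nonneg _ _ _

lemma gam_conv {s t : ℝ} (hs : 0 ≤ s) (ht : 0 ≤ t) : gam s ∗ gam t = gam (s + t) := by
  unfold gam
  rw [gaussianReal_conv_gaussianReal, Real.toNNReal_add hs ht, add_zero]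

lemma mu_conv {s t : ℝ} (hs : 0 ≤ s) (ht : 0 ≤ t) : mu s ∗ gam t = mu (s + t) := by
  unfold mu
  rw [Measure.conv_assoc, gam_conv hs ht]

lemma dens_cont (s : ℝ) : Continuous (ditherGaussDensity s) := by
  unfold ditherGaussDensity
  apply continuous_parametric_integral_of_continuous
  · exact (gpdf_cont _).comp (by fun_prop : Continuous fun p : ℝ × ℝ => p.1 - p.2)
  · exact isCompact_Icc

lemma dens_conv_ae {s t : ℝ} (hs : 0 < s) (ht : 0 < t) :
    ∀ᵐ w : ℝ, ∫⁻ v, gaussianPDF 0 t.toNNReal (w - v) * ENNReal.ofReal (ditherGaussDensity s v)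
      = ENNReal.ofReal (ditherGaussDensity (s + t) w) := by
  have h := mu_conv hs.le ht.le
  rw [mu_eq (add_pos hs ht)] at h
  unfold gam at h
  have hm := measurable_gaussianPDF 0 t.toNNReal
  have hc := dens_cont
  rw [gaussianReal_of_var_ne_zero _ (toNN_ne ht), conv_withDensity _ _ hm,
    withDensity_eq_iff_of_sigmaFinite] at h
  · filter_upwards [h] with w hw
    rw [← hw, mu_eq hs, lintegral_withDensity_eq_lintegral_mul]
    · simp [mul_comm]
    · exact (hc s).measurable.ennreal_ofReal
    · fun_prop
  · apply Measurable.aemeasurable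
    apply Measurable.lintegral_prod_right' (f := fun p : ℝ × ℝ => gaussianPDF 0 t.toNNReal (p.1 - p.2))
    fun_prop
  · exact (hc _).measurable.ennreal_ofReal.aemeasurable

lemma triple (ft fr P1 P2 P3 : ℝ → ℝ≥0∞) (hft : Measurable ft) (hfr : Measurable fr)
    (h1 : Measurable P1) (h2 : Measurable P2) (h3 : Measurable P3)
    (e2 : ∀ᵐ w : ℝ, ∫⁻ v, ft (w - v) * P2 v = P3 w)
    (e1 : ∀ᵐ w : ℝ, ∫⁻ v, fr (w - v) * P1 v = P3 w) :
    ∫⁻ y, ∫⁻ b, ∫⁻ n, ft b * (fr n * (P1 (y + b) * P2 (y + n) * (P3 (y + (b + n)))⁻¹))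
      ≤ ∫⁻ w, P3 w := by
  calc _ = ∫⁻ y, ∫⁻ n, ∫⁻ b, ft b * (fr n * (P1 (y + b) * P2 (y + n) * (P3 (y + (b + n)))⁻¹)) := by
        refine lintegral_congr fun y => ?_
        rw [lintegral_lintegral_swap (by fun_prop)]
    _ = ∫⁻ y, ∫⁻ n, ∫⁻ w, ft (w - (y + n)) * (fr n * (P1 (w - n) * P2 (y + n) * (P3 w)⁻¹)) := by
        refine lintegral_congr fun y => lintegral_congr fun n => ?_
        rw [← lintegral_sub_right_eq_self _ (y + n)]
        refine lintegral_congr fun w => ?_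
        congr 5
        · ring_nf
        · ring_nf
    _ = ∫⁻ n, ∫⁻ w, ∫⁻ y, ft (w - (y + n)) * (fr n * (P1 (w - n) * P2 (y + n) * (P3 w)⁻¹)) := by
        rw [lintegral_lintegral_swap]
        · refine lintegral_congr fun n => ?_
          rw [lintegral_lintegral_swap (by fun_prop)]
        · apply Measurable.aemeasurable
          apply Measurable.lintegral_prod_right' (f := fun q : (ℝ × ℝ) × ℝ => 
            ft (q.2 - (q.1.1 + q.1.2)) * (fr q.1.2 * (P1 (q.2 - q.1.2) * P2 (q.1.1 + q.1.2) * (P3 q.2)⁻¹)))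
          fun_prop
    _ = ∫⁻ n, ∫⁻ w, ∫⁻ v, (fr n * (P1 (w - n) * (P3 w)⁻¹)) * (ft (w - v) * P2 v) := by
        refine lintegral_congr fun n => lintegral_congr fun w => ?_
        rw [← lintegral_sub_right_eq_self _ n]
        refine lintegral_congr fun v => ?_
        simp only [sub_add_cancel]
        ring
    _ = ∫⁻ n, ∫⁻ w, (fr n * (P1 (w - n) * (P3 w)⁻¹)) * P3 w := by
        refine lintegral_congr fun n => lintegral_congr_ae ?_
        filter_upwards [e2] with w hw
        rw [lintegral_const_mul _ (by fun_prop), hw]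
    _ = ∫⁻ w, ∫⁻ n, (fr n * (P1 (w - n) * (P3 w)⁻¹)) * P3 w := by
        rw [lintegral_lintegral_swap (by fun_prop)]
    _ = ∫⁻ w, ∫⁻ v, ((P3 w)⁻¹ * P3 w) * (fr (w - v) * P1 v) := by
        refine lintegral_congr fun w => ?_
        rw [← lintegral_sub_left_eq_self _ w]
        refine lintegral_congr fun v => ?_
        simp only [sub_sub_cancel]
        ring
    _ = ∫⁻ w, ((P3 w)⁻¹ * P3 w) * P3 w := by
        refine lintegral_congr_ae ?_
        filter_upwards [e1] with w hw
        rw [lintegral_const_mul _ (by fun_prop), hw]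
    _ ≤ ∫⁻ w, P3 w := by
        refine lintegral_mono fun w => ?_
        calc _ ≤ 1 * P3 w := by
              gcongr
              exact ENNReal.inv_mul_le_one _
          _ = _ := one_mul _

end NTC

namespace NTC

lemma dens_pos {s : ℝ} (hs : 0 < s) (x : ℝ) : 0 < ditherGaussDensity s x := by
  unfold ditherGaussDensity
  rw [integral_pos_iff_support_of_nonneg]
  · have : Function.support (fun u => gaussianPDFReal 0 s.toNNReal (x - u)) = Set.univ := by
      ext u
      simp [(gaussianPDFReal_pos 0 s.toNNReal (x - u) (toNN_ne hs)).ne']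
    rw [this]
    simp
  · intro u; exact gaussianPDFReal_nonneg _ _ _
  · apply Continuous.integrableOn_Icc
    exact (gpdf_cont _).comp (by fun_prop)

lemma dens_even (s : ℝ) (x : ℝ) : ditherGaussDensity s (-x) = ditherGaussDensity s x := by
  unfold ditherGaussDensity
  rw [integral_Icc_eq_integral_Ioc, integral_Icc_eq_integral_Ioc,
    ← intervalIntegral.integral_of_le (by norm_num), ← intervalIntegral.integral_of_le (by norm_num)]
  have := intervalIntegral.integral_comp_neg (a := -(1/2:ℝ)) (b := 1/2)
    (fun u => gaussianPDFReal 0 s.toNNReal (x - u))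
  rw [neg_neg] at this
  rw [← this]
  congr 1
  ext u
  simp only [gaussianPDFReal]
  congr 3
  ring

lemma dens_log_bound {s : ℝ} (hs : 0 < s) :
    ∃ C : ℝ, ∀ x, |Real.log (ditherGaussDensity s x)| ≤ C * (1 + x ^ 2) := by
  set A : ℝ := (√(2 * Real.pi * s))⁻¹ with hA
  have hApos : 0 < A := by positivity
  have hpdf : ∀ z, gaussianPDFReal 0 s.toNNReal z = A * Real.exp (-z ^ 2 / (2 * s)) := by
    intro z
    simp [gaussianPDFReal, hA, Real.coe_toNNReal s hs.le]
  have hvol : (volume : Measure ℝ).real (Set.Icc (-(1/2) : ℝ) (1/2)) = 1 := by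
    rw [Real.volume_real_Icc]; norm_num
  have hinteg : ∀ x, IntegrableOn (fun u => gaussianPDFReal 0 s.toNNReal (x - u))
      (Set.Icc (-(1/2) : ℝ) (1/2)) := by
    intro x
    apply Continuous.integrableOn_Icc
    exact (gpdf_cont _).comp (by fun_prop)
  have hup : ∀ x, ditherGaussDensity s x ≤ A := by
    intro x
    unfold ditherGaussDensity
    calc _ ≤ ∫ u in Set.Icc (-(1/2) : ℝ) (1/2), A := by
          refine setIntegral_mono_on (hinteg x) (by simp) measurableSet_Icc ?_
          intro u _
          rw [hpdf]
          have : Real.exp (-(x - u) ^ 2 / (2 * s)) ≤ 1 := by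
            rw [Real.exp_le_one_iff]
            apply div_nonpos_of_nonpos_of_nonneg
            · nlinarith [sq_nonneg (x - u)]
            · positivity
          nlinarith
      _ = A := by rw [setIntegral_const, hvol]; simp
  have hlo : ∀ x, A * Real.exp (-(2 * x ^ 2 + 1 / 2) / (2 * s)) ≤ ditherGaussDensity s x := by
    intro x
    unfold ditherGaussDensity
    calc A * Real.exp (-(2 * x ^ 2 + 1 / 2) / (2 * s))
        = ∫ u in Set.Icc (-(1/2) : ℝ) (1/2), A * Real.exp (-(2 * x ^ 2 + 1 / 2) / (2 * s)) := by
          rw [setIntegral_const, hvol]; simp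
      _ ≤ _ := by
          refine setIntegral_mono_on continuous_const.integrableOn_Icc (hinteg x) measurableSet_Icc ?_
          intro u hu
          rw [hpdf]
          gcongr
          have : u ^ 2 ≤ 1 / 4 := by nlinarith [hu.1, hu.2]
          nlinarith [sq_nonneg (x + u)]
  refine ⟨|Real.log A| + 1 / s, fun x => ?_⟩
  have h1 : Real.log (ditherGaussDensity s x) ≤ Real.log A :=
    Real.log_le_log (dens_pos hs x) (hup x)
  have h2 : Real.log A + (-(2 * x ^ 2 + 1 / 2) / (2 * s)) ≤ Real.log (ditherGaussDensity s x) := by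
    rw [← Real.log_exp (-(2 * x ^ 2 + 1 / 2) / (2 * s)), ← Real.log_mul hApos.ne' (Real.exp_ne_zero _)]
    exact Real.log_le_log (by positivity) (hlo x)
  have h3 : (2 * x ^ 2 + 1 / 2) / (2 * s) ≤ 1 / s * (1 + x ^ 2) := by
    rw [div_le_iff₀ (by positivity)]
    field_simp
    nlinarith [sq_nonneg x]
  rw [neg_div] at h2
  have h4 : 0 ≤ |Real.log A| * x ^ 2 := by positivity
  have h5 : 0 ≤ 1 / s * (1 + x ^ 2) := by positivity
  rw [abs_le]
  constructor
  · nlinarith [neg_abs_le (Real.log A)]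
  · nlinarith [le_abs_self (Real.log A)]

lemma sq_int (s : ℝ) : Integrable (fun x : ℝ => x ^ 2) (mu s) := by
  have h : MemLp (fun x : ℝ => x) 2 (mu s) := by
    unfold mu Measure.conv
    rw [memLp_map_measure_iff (by fun_prop) (by fun_prop)]
    have hU : MemLp (fun x : ℝ => x) 2 U := by
      apply MemLp.of_bound (by fun_prop) (1/2)
      unfold U
      filter_upwards [ae_restrict_mem measurableSet_Icc] with x hx
      rw [Real.norm_eq_abs, abs_le]; exact hx
    have hG : MemLp (fun x : ℝ => x) 2 (gam s) := memLp_id_gaussianReal' 2 (by simp)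
    have h1 : MemLp (fun p : ℝ × ℝ => p.1) 2 (U.prod (gam s)) :=
      hU.comp_measurePreserving measurePreserving_fst
    have h2 : MemLp (fun p : ℝ × ℝ => p.2) 2 (U.prod (gam s)) :=
      hG.comp_measurePreserving measurePreserving_snd
    exact h1.add h2
  exact h.integrable_sq

lemma log_int {s : ℝ} (hs : 0 < s) :
    Integrable (fun x => Real.log (ditherGaussDensity s x)) (mu s) := by
  obtain ⟨C, hC⟩ := dens_log_bound hs
  refine Integrable.mono' (((integrable_const 1).add (sq_int s)).const_mul C) ?_
    (Filter.Eventually.of_forall fun x => hC x)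
  exact (Real.measurable_log.comp (dens_cont s).measurable).aestronglyMeasurable

lemma ent_eq {s : ℝ} (hs : 0 < s) :
    ditherGaussEntropy s = - ∫ x, Real.log (ditherGaussDensity s x) ∂(mu s) := by
  unfold ditherGaussEntropy
  rw [mu_eq hs, integral_withDensity_eq_integral_toReal_smul]
  · congr 2
    ext x
    simp [ENNReal.toReal_ofReal (dens_pos hs x).le]
  · exact (dens_cont s).measurable.ennreal_ofReal
  · simp

lemma vol_ac {s : ℝ} (hs : 0 < s) : (volume : Measure ℝ) ≪ mu s := by
  rw [mu_eq hs]
  apply withDensity_absolutelyContinuous'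
  · exact (dens_cont s).measurable.ennreal_ofReal.aemeasurable
  · exact Filter.Eventually.of_forall fun x => by simp [dens_pos hs x]

lemma mass_one {s : ℝ} (hs : 0 < s) : ∫⁻ x, ENNReal.ofReal (ditherGaussDensity s x) = 1 := by
  have := measure_univ (μ := mu s)
  rwa [mu_eq hs, withDensity_apply _ MeasurableSet.univ, setLIntegral_univ] at this

end NTC

namespace NTC

/-- Strict submodularity (strict concavity) of the entropy. -/
lemma ent_strict {s t r : ℝ} (hs : 0 < s) (ht : 0 < t) (hr : 0 < r) :
    ditherGaussEntropy s + ditherGaussEntropy (s + t + r) <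
      ditherGaussEntropy (s + t) + ditherGaussEntropy (s + r) := by
  have hst : 0 < s + t := by positivity
  have hsr : 0 < s + r := by positivity
  have hstr : 0 < s + t + r := by positivity
  set p0 := ditherGaussDensity s with hp0
  set p1 := ditherGaussDensity (s + t) with hp1
  set p2 := ditherGaussDensity (s + r) with hp2
  set p3 := ditherGaussDensity (s + t + r) with hp3
  have c0 : Continuous p0 := dens_cont _
  have c1 : Continuous p1 := dens_cont _
  have c2 : Continuous p2 := dens_cont _
  have c3 : Continuous p3 := dens_cont _
  have q0 : ∀ x, 0 < p0 x := dens_pos hs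
  have q1 : ∀ x, 0 < p1 x := dens_pos hst
  have q2 : ∀ x, 0 < p2 x := dens_pos hsr
  have q3 : ∀ x, 0 < p3 x := dens_pos hstr
  set P : Measure (ℝ × ℝ × ℝ) := (mu s).prod ((gam t).prod (gam r)) with hP
  -- the four marginals
  have m0 : MeasurePreserving (fun z : ℝ × ℝ × ℝ => z.1) P (mu s) := measurePreserving_fst
  have m1 : MeasurePreserving (fun z : ℝ × ℝ × ℝ => z.1 + z.2.1) P (mu (s + t)) := by
    have h1 : MeasurePreserving (fun z : ℝ × ℝ × ℝ => (z.1, z.2.1)) P ((mu s).prod (gam t)) :=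
      (MeasurePreserving.id (mu s)).prod measurePreserving_fst
    have h2 : MeasurePreserving (fun z : ℝ × ℝ => z.1 + z.2) ((mu s).prod (gam t)) (mu (s + t)) :=
      ⟨by fun_prop, mu_conv hs.le ht.le⟩
    exact h2.comp h1
  have m2 : MeasurePreserving (fun z : ℝ × ℝ × ℝ => z.1 + z.2.2) P (mu (s + r)) := by
    have h1 : MeasurePreserving (fun z : ℝ × ℝ × ℝ => (z.1, z.2.2)) P ((mu s).prod (gam r)) :=
      (MeasurePreserving.id (mu s)).prod measurePreserving_snd
    have h2 : MeasurePreserving (fun z : ℝ × ℝ => z.1 + z.2) ((mu s).prod (gam r)) (mu (s + r)) :=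
      ⟨by fun_prop, mu_conv hs.le hr.le⟩
    exact h2.comp h1
  have m3 : MeasurePreserving (fun z : ℝ × ℝ × ℝ => z.1 + (z.2.1 + z.2.2)) P (mu (s + t + r)) := by
    have h0 : MeasurePreserving (fun z : ℝ × ℝ => z.1 + z.2) ((gam t).prod (gam r)) (gam (t + r)) :=
      ⟨by fun_prop, gam_conv ht.le hr.le⟩
    have h1 : MeasurePreserving (fun z : ℝ × ℝ × ℝ => (z.1, z.2.1 + z.2.2)) P
        ((mu s).prod (gam (t + r))) :=
      (MeasurePreserving.id (mu s)).prod h0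
    have h2 : MeasurePreserving (fun z : ℝ × ℝ => z.1 + z.2) ((mu s).prod (gam (t + r)))
        (mu (s + t + r)) :=
      ⟨by fun_prop, by rw [add_assoc]; exact mu_conv hs.le (by positivity)⟩
    exact h2.comp h1
  have i0 : Integrable (fun z : ℝ × ℝ × ℝ => Real.log (p0 z.1)) P :=
    m0.integrable_comp_of_integrable (log_int hs)
  have i1 : Integrable (fun z : ℝ × ℝ × ℝ => Real.log (p1 (z.1 + z.2.1))) P :=
    m1.integrable_comp_of_integrable (log_int hst)
  have i2 : Integrable (fun z : ℝ × ℝ × ℝ => Real.log (p2 (z.1 + z.2.2))) P :=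
    m2.integrable_comp_of_integrable (log_int hsr)
  have i3 : Integrable (fun z : ℝ × ℝ × ℝ => Real.log (p3 (z.1 + (z.2.1 + z.2.2)))) P :=
    m3.integrable_comp_of_integrable (log_int hstr)
  have ecomp : ∀ {v : ℝ} {f : ℝ × ℝ × ℝ → ℝ}, 0 < v → MeasurePreserving f P (mu v) →
      ∫ z, Real.log (ditherGaussDensity v (f z)) ∂P = - ditherGaussEntropy v := by
    intro v f hv hf
    rw [ent_eq hv, neg_neg, ← hf.map_eq, integral_map hf.measurable.aemeasurable]
    exact (Real.measurable_log.comp (dens_cont v).measurable).aestronglyMeasurable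
  have e0 := ecomp hs m0
  have e1 := ecomp hst m1
  have e2 := ecomp hsr m2
  have e3 := ecomp hstr m3
  -- the likelihood ratio
  set R : ℝ × ℝ × ℝ → ℝ := fun z =>
    p1 (z.1 + z.2.1) * p2 (z.1 + z.2.2) / (p0 z.1 * p3 (z.1 + (z.2.1 + z.2.2))) with hR
  have Rpos : ∀ z, 0 < R z := fun z =>
    div_pos (mul_pos (q1 _) (q2 _)) (mul_pos (q0 _) (q3 _))
  have Rcont : Continuous R := by
    refine Continuous.div ?_ ?_ fun z => (mul_pos (q0 _) (q3 _)).ne'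
    · exact (c1.comp (by fun_prop)).mul (c2.comp (by fun_prop))
    · exact (c0.comp (by fun_prop)).mul (c3.comp (by fun_prop))
  have Rlog : ∀ z, Real.log (R z) = Real.log (p1 (z.1 + z.2.1)) + Real.log (p2 (z.1 + z.2.2))
      - (Real.log (p0 z.1) + Real.log (p3 (z.1 + (z.2.1 + z.2.2)))) := by
    intro z
    rw [hR]
    simp only
    rw [Real.log_div (mul_pos (q1 _) (q2 _)).ne' (mul_pos (q0 _) (q3 _)).ne',
      Real.log_mul (q1 _).ne' (q2 _).ne', Real.log_mul (q0 _).ne' (q3 _).ne']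
  have ilog : Integrable (fun z => Real.log (R z)) P := by
    simp_rw [Rlog]
    exact (i1.add i2).sub (i0.add i3)
  have elog : ∫ z, Real.log (R z) ∂P = ditherGaussEntropy s + ditherGaussEntropy (s + t + r) -
      (ditherGaussEntropy (s + t) + ditherGaussEntropy (s + r)) := by
    simp_rw [Rlog]
    refine (integral_sub (i1.add i2) (i0.add i3)).trans ?_
    simp only [Pi.add_apply]
    rw [integral_add i1 i2, integral_add i0 i3, e0, e1, e2, e3]
    ring
  -- total mass of the ratio
  have Rl : ∫⁻ z, ENNReal.ofReal (R z) ∂P ≤ 1 := by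
    rw [hP, lintegral_prod _ (by fun_prop)]
    have hm0 : Measurable fun x => ENNReal.ofReal (p0 x) := c0.measurable.ennreal_ofReal
    have hm1 : Measurable fun x => ENNReal.ofReal (p1 x) := c1.measurable.ennreal_ofReal
    have hm2 : Measurable fun x => ENNReal.ofReal (p2 x) := c2.measurable.ennreal_ofReal
    have hm3 : Measurable fun x => ENNReal.ofReal (p3 x) := c3.measurable.ennreal_ofReal
    have ht' := measurable_gaussianPDF 0 t.toNNReal
    have hr' := measurable_gaussianPDF 0 r.toNNReal
    have key := triple (gaussianPDF 0 t.toNNReal) (gaussianPDF 0 r.toNNReal) _ _ _ ht' hr'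
      hm1 hm2 hm3 (by
        have := dens_conv_ae hsr ht
        rwa [show s + r + t = s + t + r by ring] at this) (dens_conv_ae hst hr)
    rw [mass_one hstr] at key
    refine le_trans (le_of_eq ?_) key
    have hin : ∀ y, ∫⁻ z : ℝ × ℝ, ENNReal.ofReal (R (y, z)) ∂((gam t).prod (gam r)) =
        ∫⁻ b, ∫⁻ n, gaussianPDF 0 t.toNNReal b * (gaussianPDF 0 r.toNNReal n *
          ENNReal.ofReal (R (y, b, n))) := by
      intro y
      have hRy : Measurable fun z : ℝ × ℝ => ENNReal.ofReal (R (y, z)) := by fun_prop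
      rw [lintegral_prod _ hRy.aemeasurable]
      unfold gam
      rw [gaussianReal_of_var_ne_zero _ (toNN_ne ht), gaussianReal_of_var_ne_zero _ (toNN_ne hr),
        lintegral_withDensity_eq_lintegral_mul _ ht']
      · refine lintegral_congr fun b => ?_
        simp only [Pi.mul_apply]
        rw [lintegral_withDensity_eq_lintegral_mul _ hr' (by fun_prop)]
        rw [lintegral_const_mul _ (by fun_prop)]
        rfl
      · exact hRy.lintegral_prod_right'
    simp_rw [hin]
    rw [mu_eq hs, lintegral_withDensity_eq_lintegral_mul _ hm0]
    · refine lintegral_congr fun y => ?_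
      simp only [Pi.mul_apply]
      rw [← lintegral_const_mul]
      · refine lintegral_congr fun b => ?_
        rw [← lintegral_const_mul _ (by fun_prop)]
        refine lintegral_congr fun n => ?_
        have : ENNReal.ofReal (p0 y) * ENNReal.ofReal (R (y, b, n)) =
            ENNReal.ofReal (p1 (y + b)) * ENNReal.ofReal (p2 (y + n)) *
              (ENNReal.ofReal (p3 (y + (b + n))))⁻¹ := by
          rw [← ENNReal.ofReal_mul (q0 _).le, ← ENNReal.ofReal_inv_of_pos (q3 _),
            ← ENNReal.ofReal_mul (q1 _).le, ← ENNReal.ofReal_mul (mul_pos (q1 _) (q2 _)).le]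
          congr 1
          simp only [hR]
          have := (q0 y).ne'
          have := (q3 (y + (b + n))).ne'
          field_simp
        rw [← this]
        ring
      · apply Measurable.lintegral_prod_right' (f := fun z : ℝ × ℝ =>
          gaussianPDF 0 t.toNNReal z.1 * (gaussianPDF 0 r.toNNReal z.2 *
          ENNReal.ofReal (R (y, z.1, z.2))))
        fun_prop
    · apply Measurable.lintegral_prod_right' (f := fun q : ℝ × ℝ =>
          ∫⁻ n, gaussianPDF 0 t.toNNReal q.2 * (gaussianPDF 0 r.toNNReal n *
          ENNReal.ofReal (R (q.1, q.2, n))))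
      apply Measurable.lintegral_prod_right' (f := fun q : (ℝ × ℝ) × ℝ =>
          gaussianPDF 0 t.toNNReal q.1.2 * (gaussianPDF 0 r.toNNReal q.2 *
          ENNReal.ofReal (R (q.1.1, q.1.2, q.2))))
      fun_prop
  have iR : Integrable R P := by
    refine ⟨Rcont.measurable.aestronglyMeasurable, ?_⟩
    rw [hasFiniteIntegral_iff_ofReal (Filter.Eventually.of_forall fun z => (Rpos z).le)]
    exact Rl.trans_lt ENNReal.one_lt_top
  have eR : ∫ z, R z ∂P ≤ 1 := by
    rw [integral_eq_lintegral_of_nonneg_ae (Filter.Eventually.of_forall fun z => (Rpos z).le)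
      Rcont.measurable.aestronglyMeasurable]
    exact ENNReal.toReal_le_of_le_ofReal zero_le_one (by simpa using Rl)
  -- strict Jensen
  have hnn : ∀ z, 0 ≤ R z - 1 - Real.log (R z) := fun z => by
    linarith [Real.log_le_sub_one_of_pos (Rpos z)]
  have iall : Integrable (fun z => R z - 1 - Real.log (R z)) P := (iR.sub (integrable_const 1)).sub ilog
  have eall : ∫ z, (R z - 1 - Real.log (R z)) ∂P = ∫ z, R z ∂P - 1 - ∫ z, Real.log (R z) ∂P := by
    refine (integral_sub (iR.sub (integrable_const 1)) ilog).trans ?_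
    simp only [Pi.sub_apply]
    rw [integral_sub iR (integrable_const 1)]
    simp
  have hnn' : 0 ≤ ∫ z, (R z - 1 - Real.log (R z)) ∂P := integral_nonneg hnn
  by_contra hcon
  push Not at hcon
  have hz : ∫ z, (R z - 1 - Real.log (R z)) ∂P = 0 := by
    apply le_antisymm _ hnn'
    rw [eall, elog]; linarith
  rw [integral_eq_zero_iff_of_nonneg hnn iall] at hz
  have hone : ∀ᵐ z ∂P, R z = 1 := by
    filter_upwards [hz] with z hz
    by_contra hne
    have := Real.log_lt_sub_one_of_pos (Rpos z) hne
    simp only [Pi.zero_apply] at hz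
    linarith
  have hac : (volume : Measure (ℝ × ℝ × ℝ)) ≪ P :=
    (vol_ac hs).prod ((gaussianReal_absolutelyContinuous' 0 (toNN_ne ht)).prod
      (gaussianReal_absolutelyContinuous' 0 (toNN_ne hr)))
  have hone' : R =ᵐ[volume] fun _ => (1 : ℝ) := hac.ae_le hone
  have hall : R = fun _ => (1 : ℝ) := (Continuous.ae_eq_iff_eq volume Rcont continuous_const).1 hone'
  have heq : ∀ y b n, p1 (y + b) * p2 (y + n) = p0 y * p3 (y + (b + n)) := by
    intro y b n
    have := congrFun hall (y, b, n)
    simp only [hR] at this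
    rwa [div_eq_one_iff_eq (mul_pos (q0 _) (q3 _)).ne'] at this
  have hconst : ∀ x, p3 x = p3 0 := by
    intro x
    have h1 := heq 0 (x/2) (x/2)
    have h2 := heq 0 (x/2) (-(x/2))
    have h3 : p2 (-(x/2)) = p2 (x/2) := dens_even _ _
    simp only [zero_add] at h1 h2
    rw [h3, h1, add_neg_cancel] at h2
    have h4 := mul_left_cancel₀ (q0 0).ne' h2
    rwa [add_halves] at h4
  have hm := mass_one hstr
  have hm' : ∫⁻ _ : ℝ, ENNReal.ofReal (p3 0) = 1 := by
    rw [← hm]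
    refine lintegral_congr fun x => ?_
    rw [← hconst x]
  rw [lintegral_const, Real.volume_univ, ENNReal.mul_top (by simp [q3 0])] at hm'
  exact ENNReal.top_ne_one hm'

end NTC

namespace NTC

lemma ent_schur {a a' b b' : ℝ} (h0 : 0 < a') (h1 : a' < a) (h2 : a' < b) (h3 : a' + b' = a + b) :
    ditherGaussEntropy a' + ditherGaussEntropy b' < ditherGaussEntropy a + ditherGaussEntropy b := by
  have := ent_strict h0 (sub_pos.2 h1) (sub_pos.2 h2)
  rw [show a' + (a - a') + (b - a') = b' by linarith, show a' + (a - a') = a by ring,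
    show a' + (b - a') = b by ring] at this
  exact this

lemma lin_zero {L C : ℝ} (h : ∀ τ : ℝ, |τ| < 1 → L * τ + C * τ ^ 2 ≤ 0) : L = 0 := by
  by_contra hL
  have hpos : 0 < 1 + |L| + |C| := by positivity
  have hL2 : 0 < L ^ 2 := by positivity
  have hτ : |L / (1 + |L| + |C|)| < 1 := by
    rw [abs_div, abs_of_pos hpos, div_lt_one hpos]
    linarith [abs_nonneg C]
  have := h _ hτ
  have e : L * (L / (1 + |L| + |C|)) + C * (L / (1 + |L| + |C|)) ^ 2
      = L ^ 2 * (1 + |L| + |C| + C) / (1 + |L| + |C|) ^ 2 := by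
    field_simp
  rw [e] at this
  have : 0 < L ^ 2 * (1 + |L| + |C| + C) / (1 + |L| + |C|) ^ 2 := by
    have : 0 < 1 + |L| + |C| + C := by linarith [neg_abs_le C, abs_nonneg L]
    positivity
  linarith

section core

variable {d : ℕ} {E : Type*} [AddCommGroup E] [Module ℝ E]

/-- cost of one column -/
noncomputable def cost (B Q : E →ₗ[ℝ] E →ₗ[ℝ] ℝ) (lam : ℝ) (v : E) : ℝ :=
  -(Q v v / (B v v + 1 / 12)) + lam * ditherGaussEntropy (B v v)

variable (B Q : E →ₗ[ℝ] E →ₗ[ℝ] ℝ) (lam : ℝ)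

lemma pair_opt (hBs : ∀ x y, B x y = B y x)
    (w : Fin d → E) (horth : ∀ i j, i ≠ j → B (w i) (w j) = 0)
    (hopt : ∀ w' : Fin d → E, (∀ i j, i ≠ j → B (w' i) (w' j) = 0) →
      ∑ k, cost B Q lam (w k) ≤ ∑ k, cost B Q lam (w' k))
    (i j : Fin d) (hij : i ≠ j) (v v' : E) (hvv : B v v' = 0)
    (hv : ∀ k, k ≠ i → k ≠ j → B v (w k) = 0) (hv' : ∀ k, k ≠ i → k ≠ j → B v' (w k) = 0) :
    cost B Q lam (w i) + cost B Q lam (w j) ≤ cost B Q lam v + cost B Q lam v' := by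
  have h := hopt (fun k => if k = i then v else if k = j then v' else w k) (by
    intro k l hkl
    by_cases hki : k = i <;> by_cases hkj : k = j <;> by_cases hli : l = i <;>
      by_cases hlj : l = j <;> simp_all)
  rw [← sub_nonneg, ← Finset.sum_sub_distrib, Fintype.sum_eq_add i j hij] at h
  · simp [hij.symm] at h
    linarith
  · intro k hk
    simp [hk.1, hk.2]

lemma single_opt (hBs : ∀ x y, B x y = B y x)
    (w : Fin d → E) (horth : ∀ i j, i ≠ j → B (w i) (w j) = 0)
    (hopt : ∀ w' : Fin d → E, (∀ i j, i ≠ j → B (w' i) (w' j) = 0) →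
      ∑ k, cost B Q lam (w k) ≤ ∑ k, cost B Q lam (w' k))
    (i : Fin d) (v : E) (hv : ∀ k, k ≠ i → B v (w k) = 0) :
    cost B Q lam (w i) ≤ cost B Q lam v := by
  have h := hopt (fun k => if k = i then v else w k) (by
    intro k l hkl
    by_cases hki : k = i <;> by_cases hli : l = i <;> simp_all)
  rw [← sub_nonneg, ← Finset.sum_sub_distrib, Fintype.sum_eq_single i] at h
  · simp at h
    linarith
  · intro k hk
    simp [hk]

lemma core_orth (hBs : ∀ x y, B x y = B y x) (hQs : ∀ x y, Q x y = Q y x)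
    (hBp : ∀ x, x ≠ 0 → 0 < B x x)
    (w : Fin d → E) (horth : ∀ i j, i ≠ j → B (w i) (w j) = 0)
    (hopt : ∀ w' : Fin d → E, (∀ i j, i ≠ j → B (w' i) (w' j) = 0) →
      ∑ k, cost B Q lam (w k) ≤ ∑ k, cost B Q lam (w' k))
    (i : Fin d) (hi : w i ≠ 0) (v : E) (hv : ∀ k, B v (w k) = 0) : Q (w i) v = 0 := by
  by_cases hv0 : v = 0
  · simp [hv0]
  have hs := hBp _ hi
  have hσ := hBp _ hv0
  set s := B (w i) (w i) with hsdef
  set σ := B v v with hσdef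
  have key : ∀ τ : ℝ, |τ| < 1 → (2 * s * Q (w i) v) * τ + (s * Q v v - Q (w i) (w i) * σ) * τ ^ 2 ≤ 0 := by
    intro τ _
    have hden : 0 < s + τ ^ 2 * σ := by positivity
    set κ := √(s / (s + τ ^ 2 * σ)) with hκ
    have hκ2 : κ ^ 2 = s / (s + τ ^ 2 * σ) := Real.sq_sqrt (by positivity)
    have h := single_opt B Q lam hBs w horth hopt i (κ • (w i + τ • v)) (by
      intro k hk
      simp [horth i k (Ne.symm hk), hv k])
    have hB : B (κ • (w i + τ • v)) (κ • (w i + τ • v)) = s := by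
      have : B (κ • (w i + τ • v)) (κ • (w i + τ • v)) = κ ^ 2 * (s + τ ^ 2 * σ) := by
        simp [hBs (w i) v, hv i, ← hsdef, ← hσdef]
        ring
      rw [this, hκ2]
      field_simp
    have hQ : Q (κ • (w i + τ • v)) (κ • (w i + τ • v)) =
        κ ^ 2 * (Q (w i) (w i) + 2 * τ * Q (w i) v + τ ^ 2 * Q v v) := by
      simp [hQs v (w i)]
      ring
    unfold cost at h
    rw [hB, hQ, ← hsdef] at h
    have h' : κ ^ 2 * (Q (w i) (w i) + 2 * τ * Q (w i) v + τ ^ 2 * Q v v) / (s + 1 / 12)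
        ≤ Q (w i) (w i) / (s + 1 / 12) := by linarith
    rw [div_le_div_iff_of_pos_right (by positivity), hκ2, div_mul_eq_mul_div,
      div_le_iff₀ hden] at h'
    nlinarith
  have := lin_zero key
  have h2 : 2 * s ≠ 0 := by positivity
  simpa [hs.ne'] using this

lemma core_pair (hlam : 0 < lam) (hBs : ∀ x y, B x y = B y x) (hQs : ∀ x y, Q x y = Q y x)
    (hBp : ∀ x, x ≠ 0 → 0 < B x x)
    (w : Fin d → E) (horth : ∀ i j, i ≠ j → B (w i) (w j) = 0)
    (hopt : ∀ w' : Fin d → E, (∀ i j, i ≠ j → B (w' i) (w' j) = 0) →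
      ∑ k, cost B Q lam (w k) ≤ ∑ k, cost B Q lam (w' k))
    (i j : Fin d) (hij : i ≠ j) (hi : w i ≠ 0) (hj : w j ≠ 0) : Q (w i) (w j) = 0 := by
  have hs := hBp _ hi
  have ht := hBp _ hj
  have hBij := horth i j hij
  have hBji := horth j i hij.symm
  by_cases hst : B (w i) (w i) = B (w j) (w j)
  · set s := B (w i) (w i) with hsdef
    have key : ∀ τ : ℝ, |τ| < 1 → (2 * Q (w i) (w j) * (s + 1 / 12)) * τ +
        (- (s * (Q (w i) (w i) + Q (w j) (w j)))) * τ ^ 2 ≤ 0 := by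
      intro τ hτ
      rw [abs_lt] at hτ
      have hp : 0 < 1 + τ := by linarith
      have hm : 0 < 1 - τ := by linarith
      set x := √((1 + τ) / 2) with hx
      set y := √((1 - τ) / 2) with hy
      have hx2 : x ^ 2 = (1 + τ) / 2 := Real.sq_sqrt (by positivity)
      have hy2 : y ^ 2 = (1 - τ) / 2 := Real.sq_sqrt (by positivity)
      have h := pair_opt B Q lam hBs w horth hopt i j hij (x • (w i + w j)) (y • (w i - w j))
        (by simp [hBij, hBji, ← hst, ← hsdef])
        (by
          intro k hki hkj
          simp [horth i k (Ne.symm hki), horth j k (Ne.symm hkj)])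
        (by
          intro k hki hkj
          simp [horth i k (Ne.symm hki), horth j k (Ne.symm hkj)])
      have hB1 : B (x • (w i + w j)) (x • (w i + w j)) = (1 + τ) * s := by
        have : B (x • (w i + w j)) (x • (w i + w j)) = x ^ 2 * (2 * s) := by
          simp [hBij, hBji, ← hst, ← hsdef]; ring
        rw [this, hx2]; ring
      have hB2 : B (y • (w i - w j)) (y • (w i - w j)) = (1 - τ) * s := by
        have : B (y • (w i - w j)) (y • (w i - w j)) = y ^ 2 * (2 * s) := by
          simp [hBij, hBji, ← hst, ← hsdef]; ring
        rw [this, hy2]; ring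
      have hQ1 : Q (x • (w i + w j)) (x • (w i + w j)) =
          (1 + τ) * ((Q (w i) (w i) + Q (w j) (w j)) / 2 + Q (w i) (w j)) := by
        have : Q (x • (w i + w j)) (x • (w i + w j)) =
            x ^ 2 * (Q (w i) (w i) + Q (w j) (w j) + 2 * Q (w i) (w j)) := by
          simp [hQs (w j) (w i)]; ring
        rw [this, hx2]; ring
      have hQ2 : Q (y • (w i - w j)) (y • (w i - w j)) =
          (1 - τ) * ((Q (w i) (w i) + Q (w j) (w j)) / 2 - Q (w i) (w j)) := by
        have : Q (y • (w i - w j)) (y • (w i - w j)) =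
            y ^ 2 * (Q (w i) (w i) + Q (w j) (w j) - 2 * Q (w i) (w j)) := by
          simp [hQs (w j) (w i)]; ring
        rw [this, hy2]; ring
      have hent : ditherGaussEntropy ((1 + τ) * s) + ditherGaussEntropy ((1 - τ) * s) ≤
          ditherGaussEntropy s + ditherGaussEntropy s := by
        rcases lt_trichotomy τ 0 with h0 | h0 | h0
        · exact (ent_schur (by positivity) (by nlinarith) (by nlinarith) (by ring)).le
        · simp [h0]
        · rw [add_comm]
          exact (ent_schur (by positivity) (by nlinarith) (by nlinarith) (by ring)).le
      unfold cost at h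
      rw [hB1, hB2, hQ1, hQ2, ← hst, ← hsdef] at h
      set P := (Q (w i) (w i) + Q (w j) (w j)) / 2 + Q (w i) (w j) with hP
      set N := (Q (w i) (w i) + Q (w j) (w j)) / 2 - Q (w i) (w j) with hN
      have hPN : P + N = Q (w i) (w i) + Q (w j) (w j) := by rw [hP, hN]; ring
      have hPN' : P - N = 2 * Q (w i) (w j) := by rw [hP, hN]; ring
      have hent' := mul_le_mul_of_nonneg_left hent hlam.le
      have h1 : (1 + τ) * P / ((1 + τ) * s + 1 / 12) + (1 - τ) * N / ((1 - τ) * s + 1 / 12)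
          ≤ (P + N) / (s + 1 / 12) := by
        rw [hPN, add_div]; linarith
      have d1 : 0 < (1 + τ) * s + 1 / 12 := by positivity
      have d2 : 0 < (1 - τ) * s + 1 / 12 := by positivity
      have d3 : 0 < s + 1 / 12 := by positivity
      have e : (1 + τ) * P / ((1 + τ) * s + 1 / 12) + (1 - τ) * N / ((1 - τ) * s + 1 / 12)
          - (P + N) / (s + 1 / 12) = (1 / 12) * (τ * ((P - N) * (s + 1 / 12) - τ * s * (P + N))) /
            (((1 + τ) * s + 1 / 12) * ((1 - τ) * s + 1 / 12) * (s + 1 / 12)) := by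
        rw [div_add_div _ _ d1.ne' d2.ne', div_sub_div _ _ (mul_pos d1 d2).ne' d3.ne']
        congr 1
        ring
      have h2 := sub_nonpos.2 h1
      rw [e, div_le_iff₀ (by positivity), zero_mul] at h2
      rw [hPN, hPN'] at h2
      linarith
    have := lin_zero key
    have h2 : s + 1 / 12 ≠ 0 := by positivity
    simpa [h2, -one_div] using this
  · set s := B (w i) (w i) with hsdef
    set t := B (w j) (w j) with htdef
    have key : ∀ τ : ℝ, |τ| < 1 → (2 * Q (w i) (w j) * (s / (s + 1 / 12) - t / (t + 1 / 12))) * τ +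
        (s ^ 2 * Q (w j) (w j) / (s + 1 / 12) + t ^ 2 * Q (w i) (w i) / (t + 1 / 12)
          - s * t * (Q (w i) (w i) / (s + 1 / 12) + Q (w j) (w j) / (t + 1 / 12))) * τ ^ 2 ≤ 0 := by
      intro τ _
      have hden : 0 < 1 + τ ^ 2 * (s * t) := by positivity
      set κ := √(1 / (1 + τ ^ 2 * (s * t))) with hκ
      have hκ2 : κ ^ 2 = 1 / (1 + τ ^ 2 * (s * t)) := Real.sq_sqrt (by positivity)
      have hκ3 : κ ^ 2 * (1 + τ ^ 2 * (s * t)) = 1 := by rw [hκ2]; field_simp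
      have h := pair_opt B Q lam hBs w horth hopt i j hij
        (κ • (w i + (τ * s) • w j)) (κ • (w j - (τ * t) • w i))
        (by simp [hBij, hBji, ← htdef, ← hsdef]; right; ring)
        (by
          intro k hki hkj
          simp [horth i k (Ne.symm hki), horth j k (Ne.symm hkj)])
        (by
          intro k hki hkj
          simp [horth i k (Ne.symm hki), horth j k (Ne.symm hkj)])
      have hB1 : B (κ • (w i + (τ * s) • w j)) (κ • (w i + (τ * s) • w j)) = s := by
        have : B (κ • (w i + (τ * s) • w j)) (κ • (w i + (τ * s) • w j)) =
            s * (κ ^ 2 * (1 + τ ^ 2 * (s * t))) := by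
          simp [hBij, hBji, ← htdef, ← hsdef]; ring
        rw [this, hκ3, mul_one]
      have hB2 : B (κ • (w j - (τ * t) • w i)) (κ • (w j - (τ * t) • w i)) = t := by
        have : B (κ • (w j - (τ * t) • w i)) (κ • (w j - (τ * t) • w i)) =
            t * (κ ^ 2 * (1 + τ ^ 2 * (s * t))) := by
          simp [hBij, hBji, ← htdef, ← hsdef]; ring
        rw [this, hκ3, mul_one]
      have hQ1 : Q (κ • (w i + (τ * s) • w j)) (κ • (w i + (τ * s) • w j)) =
          κ ^ 2 * (Q (w i) (w i) + 2 * τ * s * Q (w i) (w j) + τ ^ 2 * s ^ 2 * Q (w j) (w j)) := by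
        simp [hQs (w j) (w i)]; ring
      have hQ2 : Q (κ • (w j - (τ * t) • w i)) (κ • (w j - (τ * t) • w i)) =
          κ ^ 2 * (Q (w j) (w j) - 2 * τ * t * Q (w i) (w j) + τ ^ 2 * t ^ 2 * Q (w i) (w i)) := by
        simp [hQs (w j) (w i)]; ring
      unfold cost at h
      rw [hB1, hB2, hQ1, hQ2, ← htdef, ← hsdef] at h
      have h1 : κ ^ 2 * ((Q (w i) (w i) + 2 * τ * s * Q (w i) (w j) + τ ^ 2 * s ^ 2 * Q (w j) (w j))
          / (s + 1 / 12) + (Q (w j) (w j) - 2 * τ * t * Q (w i) (w j) + τ ^ 2 * t ^ 2 * Q (w i) (w i))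
          / (t + 1 / 12)) ≤ Q (w i) (w i) / (s + 1 / 12) + Q (w j) (w j) / (t + 1 / 12) := by
        rw [mul_add, ← mul_div_assoc, ← mul_div_assoc]
        linarith
      rw [hκ2, one_div_mul_eq_div, div_le_iff₀ hden] at h1
      have h2 := sub_nonpos.2 h1
      refine le_trans (le_of_eq ?_) h2
      ring
    have := lin_zero key
    rcases mul_eq_zero.1 this with h | h
    · simpa using h
    · exfalso
      apply hst
      rw [sub_eq_zero, div_eq_div_iff (by positivity) (by positivity)] at h
      linarith

end core

end NTC

namespace NTC

section mat

variable {d : ℕ}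

/-- distortion gain -/
noncomputable def gain (K W : Matrix (Fin d) (Fin d) ℝ) : ℝ :=
  trace (K * W * (Wᵀ * K * W + (1 / 12 : ℝ) • (1 : Matrix (Fin d) (Fin d) ℝ))⁻¹ * Wᵀ * K)

lemma gain_rot (K W Q : Matrix (Fin d) (Fin d) ℝ) (hQ : Qᵀ * Q = 1) :
    gain K (W * Q) = gain K W := by
  have hQ' : Q * Qᵀ = 1 := mul_eq_one_comm.1 hQ
  have hinv : Q⁻¹ = Qᵀ := inv_eq_left_inv hQ
  have hinvT : Qᵀ⁻¹ = Q := inv_eq_left_inv hQ'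
  unfold gain
  have e : (W * Q)ᵀ * K * (W * Q) + (1 / 12 : ℝ) • (1 : Matrix (Fin d) (Fin d) ℝ)
      = Qᵀ * (Wᵀ * K * W + (1 / 12 : ℝ) • (1 : Matrix (Fin d) (Fin d) ℝ)) * Q := by
    rw [transpose_mul, Matrix.mul_add, Matrix.add_mul, Matrix.mul_smul, Matrix.smul_mul,
      Matrix.mul_one, hQ]
    simp only [Matrix.mul_assoc]
  rw [e, Matrix.mul_inv_rev, Matrix.mul_inv_rev, hinv, hinvT, transpose_mul]
  congr 1
  set S := (Wᵀ * K * W + (1 / 12 : ℝ) • (1 : Matrix (Fin d) (Fin d) ℝ))⁻¹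
  calc K * (W * Q) * (Qᵀ * (S * Q)) * (Qᵀ * Wᵀ) * K
      = K * W * (Q * Qᵀ) * S * (Q * Qᵀ) * Wᵀ * K := by simp only [Matrix.mul_assoc]
    _ = _ := by rw [hQ']; simp

lemma gram_apply (K W : Matrix (Fin d) (Fin d) ℝ) (i j : Fin d) :
    (Wᵀ * K * W) i j = (Wᵀ i) ⬝ᵥ (K *ᵥ (Wᵀ j)) := by
  rw [Matrix.mul_assoc, Matrix.mul_apply, dotProduct]
  refine Finset.sum_congr rfl fun k _ => ?_
  congr 1

lemma gain_diag (K W : Matrix (Fin d) (Fin d) ℝ) (hK : K.PosDef)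
    (horth : ∀ i j, i ≠ j → (Wᵀ * K * W) i j = 0) :
    gain K W = ∑ i, (Wᵀ i) ⬝ᵥ ((K * K) *ᵥ (Wᵀ i)) / ((Wᵀ * K * W) i i + 1 / 12) := by
  have hKt : Kᵀ = K := by simpa [conjTranspose_eq_transpose_of_trivial] using hK.1.eq
  have hnn : ∀ i, 0 ≤ (Wᵀ * K * W) i i := by
    intro i
    rw [gram_apply]
    simpa using hK.posSemidef.dotProduct_mulVec_nonneg (Wᵀ i)
  have hpos : ∀ i, (Wᵀ * K * W) i i + 1 / 12 ≠ 0 := fun i => by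
    have := hnn i
    positivity
  have hS : Wᵀ * K * W + (1 / 12 : ℝ) • (1 : Matrix (Fin d) (Fin d) ℝ)
      = diagonal (fun i => (Wᵀ * K * W) i i + 1 / 12) := by
    ext i j
    by_cases h : i = j
    · subst h; simp
    · simp [h, horth i j h]
  have hinv : (Wᵀ * K * W + (1 / 12 : ℝ) • (1 : Matrix (Fin d) (Fin d) ℝ))⁻¹
      = diagonal (fun i => ((Wᵀ * K * W) i i + 1 / 12)⁻¹) := by
    apply inv_eq_right_inv
    rw [hS, diagonal_mul_diagonal, ← diagonal_one]
    congr 1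
    ext i
    exact mul_inv_cancel₀ (hpos i)
  unfold gain
  rw [hinv]
  set g := fun i => ((Wᵀ * K * W) i i + 1 / 12)⁻¹ with hg
  have : trace (K * W * diagonal g * Wᵀ * K) = trace (Wᵀ * (K * K) * W * diagonal g) := by
    rw [show K * W * diagonal g * Wᵀ * K = (K * W * diagonal g) * (Wᵀ * K) by
      simp only [Matrix.mul_assoc], trace_mul_comm]
    simp only [Matrix.mul_assoc]
  rw [this, trace]
  refine Finset.sum_congr rfl fun i _ => ?_
  rw [diag_apply, mul_diagonal, gram_apply]
  simp only [hg]
  exact (div_eq_mul_inv _ _).symm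

lemma exists_rot (i j : Fin d) (hij : i ≠ j) (c s : ℝ) (hcs : c ^ 2 + s ^ 2 = 1) :
    ∃ Q : Matrix (Fin d) (Fin d) ℝ, Qᵀ * Q = 1 ∧ ∀ W : Matrix (Fin d) (Fin d) ℝ,
      (W * Q)ᵀ i = c • Wᵀ i + s • Wᵀ j ∧ (W * Q)ᵀ j = -s • Wᵀ i + c • Wᵀ j ∧
      ∀ k, k ≠ i → k ≠ j → (W * Q)ᵀ k = Wᵀ k := by
  let q : Fin d → Fin d → ℝ := fun k =>
    if k = i then c • Pi.single i 1 + s • Pi.single j 1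
    else if k = j then -s • Pi.single i 1 + c • Pi.single j 1 else Pi.single k 1
  refine ⟨(Matrix.of q)ᵀ, ?_, ?_⟩
  · ext k l
    have : ((Matrix.of q)ᵀᵀ * (Matrix.of q)ᵀ) k l = q k ⬝ᵥ q l := rfl
    rw [this, Matrix.one_apply]
    have hji := hij.symm
    by_cases hki : k = i
    · by_cases hli : l = i
      · subst hki; subst hli; simp [q, hij, hji]; linarith
      · by_cases hlj : l = j
        · subst hki; subst hlj; simp [q, hij, hji]; ring
        · subst hki; simp [q, hli, hlj, Ne.symm hli]
    · by_cases hkj : k = j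
      · subst hkj
        by_cases hli : l = i
        · subst hli; simp [q, hij, hji]; ring
        · by_cases hlj : l = k
          · subst hlj; simp [q, hij, hji]; linarith
          · simp [q, hli, hlj, hki, Ne.symm hlj]
      · by_cases hli : l = i
        · subst hli; simp [q, hki, hkj]
        · by_cases hlj : l = j
          · subst hlj; simp [q, hki, hkj, hli]
          · simp [q, hki, hkj, hli, hlj, Pi.single_apply]
            by_cases h : k = l
            · simp [h]
            · simp [h, Ne.symm h]
  · intro W
    have hcol : ∀ k, (W * (Matrix.of q)ᵀ)ᵀ k = W *ᵥ q k := fun k => rfl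
    have hsing : ∀ k, W *ᵥ (Pi.single k 1) = Wᵀ k := by
      intro k; ext a; simp
    refine ⟨?_, ?_, ?_⟩
    · rw [hcol]; simp only [q, if_true, mulVec_add, mulVec_smul, hsing]
    · rw [hcol]; simp only [q, if_true, hij.symm, if_false, mulVec_add, mulVec_smul, hsing]
    · intro k h1 h2
      rw [hcol]; simp only [q, h1, h2, if_false, hsing]

lemma pick_angle {s t β : ℝ} (ht : 0 < t) (hts : t ≤ s) (hβ : β ≠ 0) :
    ∃ c σ : ℝ, c ^ 2 + σ ^ 2 = 1 ∧ s < c ^ 2 * s + 2 * c * σ * β + σ ^ 2 * t ∧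
      0 < σ ^ 2 * s - 2 * c * σ * β + c ^ 2 * t := by
  have hβ2 : 0 < β ^ 2 := by positivity
  obtain ⟨η, hη, h1, h2⟩ : ∃ η : ℝ, 0 < η ∧ η * (s - t) < 2 ∧ 2 * η * β ^ 2 < t := by
    refine ⟨min (1 / (s - t + 1)) (t / (4 * β ^ 2)), ?_, ?_, ?_⟩
    · have : 0 < s - t + 1 := by linarith
      positivity
    · have h0 : 0 < s - t + 1 := by linarith
      calc _ ≤ 1 / (s - t + 1) * (s - t) := by
            exact mul_le_mul_of_nonneg_right (min_le_left _ _) (by linarith)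
        _ < 2 := by
            rw [one_div_mul_eq_div, div_lt_iff₀ h0]; linarith
    · calc _ ≤ 2 * (t / (4 * β ^ 2)) * β ^ 2 := by
            gcongr
            exact min_le_right _ _
        _ = t / 2 := by field_simp; ring
        _ < t := by linarith
  set τ := η * β with hτ
  set c := √(1 / (1 + τ ^ 2)) with hc
  have hc2 : c ^ 2 = 1 / (1 + τ ^ 2) := Real.sq_sqrt (by positivity)
  have hc3 : c ^ 2 * (1 + τ ^ 2) = 1 := by rw [hc2]; field_simp
  have hcp : 0 < c ^ 2 := by rw [hc2]; positivity
  refine ⟨c, τ * c, by linarith, ?_, ?_⟩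
  · have : c ^ 2 * s + 2 * c * (τ * c) * β + (τ * c) ^ 2 * t - s =
        c ^ 2 * (η * β ^ 2 * (2 - η * (s - t))) := by
      have : s = s * (c ^ 2 * (1 + τ ^ 2)) := by rw [hc3, mul_one]
      calc _ = c ^ 2 * s + 2 * c * (τ * c) * β + (τ * c) ^ 2 * t - s * (c ^ 2 * (1 + τ ^ 2)) := by
            rw [← this]
        _ = _ := by rw [hτ]; ring
    have h3 : 0 < c ^ 2 * (η * β ^ 2 * (2 - η * (s - t))) := by
      have : 0 < 2 - η * (s - t) := by linarith
      positivity
    linarith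
  · have : (τ * c) ^ 2 * s - 2 * c * (τ * c) * β + c ^ 2 * t =
        c ^ 2 * (τ ^ 2 * s + (t - 2 * η * β ^ 2)) := by rw [hτ]; ring
    rw [this]
    have h4 : 0 < t - 2 * η * β ^ 2 := by linarith
    have h5 : 0 ≤ s := by linarith
    positivity

end mat

end NTC

/-- Theorem 4: for `x ~ N(0,K)` with `K` positive definite with distinct
eigenvalues, any minimizer `W` of the factorized linear NTC objective
`tr(K) − tr(KW(WᵀKW + I/12)⁻¹WᵀK) + λ Σᵢ h(wᵢᵀx + εᵢ)` has all its nonzero columns equal to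
(scalar multiples of) eigenvectors of `K`. -/
theorem stmt_17 (d : ℕ) (K : Matrix (Fin d) (Fin d) ℝ) (lam : ℝ)
    (hK : K.PosDef) (hKh : K.IsHermitian)
    (hdistinct : ∀ i j : Fin d, i ≠ j → hKh.eigenvalues i ≠ hKh.eigenvalues j)
    (hlam : 0 < lam)
    (F : Matrix (Fin d) (Fin d) ℝ → ℝ)
    (hF : ∀ W, F W = trace K -
        trace (K * W * (Wᵀ * K * W + (1 / 12 : ℝ) • (1 : Matrix (Fin d) (Fin d) ℝ))⁻¹ * Wᵀ * K)
        + lam * ∑ i, ditherGaussEntropy ((Wᵀ * K * W) i i))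
    (W : Matrix (Fin d) (Fin d) ℝ)
    (hW_opt : ∀ V : Matrix (Fin d) (Fin d) ℝ, F W ≤ F V) :
    ∀ j : Fin d, (fun i => W i j) ≠ 0 →
      ∃ μ : ℝ, K *ᵥ (fun i => W i j) = μ • (fun i => W i j) := by
  have hKt : Kᵀ = K := by simpa [conjTranspose_eq_transpose_of_trivial] using hK.1.eq
  have hsymm : ∀ (M : Matrix (Fin d) (Fin d) ℝ), Mᵀ = M → ∀ x y : Fin d → ℝ,
      x ⬝ᵥ (M *ᵥ y) = y ⬝ᵥ (M *ᵥ x) := by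
    intro M hM x y
    rw [dotProduct_mulVec, ← mulVec_transpose, hM, dotProduct_comm]
  let B : (Fin d → ℝ) →ₗ[ℝ] (Fin d → ℝ) →ₗ[ℝ] ℝ := Matrix.toLinearMap₂' ℝ K
  let Q : (Fin d → ℝ) →ₗ[ℝ] (Fin d → ℝ) →ₗ[ℝ] ℝ := Matrix.toLinearMap₂' ℝ (K * K)
  have hB : ∀ x y, B x y = x ⬝ᵥ (K *ᵥ y) := fun x y => Matrix.toLinearMap₂'_apply' K x y
  have hQ : ∀ x y, Q x y = x ⬝ᵥ ((K * K) *ᵥ y) := fun x y => Matrix.toLinearMap₂'_apply' (K * K) x y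
  have hBs : ∀ x y, B x y = B y x := fun x y => by
    rw [hB, hB]; exact hsymm K hKt x y
  have hQs : ∀ x y, Q x y = Q y x := fun x y => by
    rw [hQ, hQ]; exact hsymm _ (by rw [transpose_mul, hKt]) x y
  have hBp : ∀ x, x ≠ 0 → 0 < B x x := fun x hx => by
    rw [hB]; simpa using hK.dotProduct_mulVec_pos hx
  have hgram : ∀ (V : Matrix (Fin d) (Fin d) ℝ) i j, (Vᵀ * K * V) i j = B (Vᵀ i) (Vᵀ j) :=
    fun V i j => by rw [hB, NTC.gram_apply]
  -- step 1: the columns are `K`-orthogonal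
  have step1 : ∀ i j, i ≠ j → B (Wᵀ j) (Wᵀ j) ≤ B (Wᵀ i) (Wᵀ i) → B (Wᵀ i) (Wᵀ j) = 0 := by
    intro i j hij hle
    by_contra hβ
    have hj0 : Wᵀ j ≠ 0 := fun h => hβ (by simp [h])
    obtain ⟨c, σ, hcs, h1, h2⟩ := NTC.pick_angle (hBp _ hj0) hle hβ
    obtain ⟨R, hR, hRW⟩ := NTC.exists_rot i j hij c σ hcs
    obtain ⟨r1, r2, r3⟩ := hRW W
    have hopt := hW_opt (W * R)
    have hg := NTC.gain_rot K W R hR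
    unfold NTC.gain at hg
    rw [hF, hF, hg] at hopt
    simp_rw [hgram] at hopt
    have hopt' : lam * ∑ k, ditherGaussEntropy (B (Wᵀ k) (Wᵀ k)) ≤
        lam * ∑ k, ditherGaussEntropy (B ((W * R)ᵀ k) ((W * R)ᵀ k)) := by linarith
    have hopt2 := le_of_mul_le_mul_left hopt' hlam
    rw [← sub_nonneg, ← Finset.sum_sub_distrib, Fintype.sum_eq_add i j hij] at hopt2
    · have b1 : B ((W * R)ᵀ i) ((W * R)ᵀ i) = c ^ 2 * B (Wᵀ i) (Wᵀ i) +
          2 * c * σ * B (Wᵀ i) (Wᵀ j) + σ ^ 2 * B (Wᵀ j) (Wᵀ j) := by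
        rw [r1]; simp [hBs (Wᵀ j) (Wᵀ i)]; ring
      have b2 : B ((W * R)ᵀ j) ((W * R)ᵀ j) = σ ^ 2 * B (Wᵀ i) (Wᵀ i) -
          2 * c * σ * B (Wᵀ i) (Wᵀ j) + c ^ 2 * B (Wᵀ j) (Wᵀ j) := by
        rw [r2]; simp [hBs (Wᵀ j) (Wᵀ i)]; ring
      rw [← b1] at h1
      rw [← b2] at h2
      have hsum : B ((W * R)ᵀ j) ((W * R)ᵀ j) + B ((W * R)ᵀ i) ((W * R)ᵀ i) =
          B (Wᵀ j) (Wᵀ j) + B (Wᵀ i) (Wᵀ i) := by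
        rw [b1, b2]
        linear_combination (B (Wᵀ i) (Wᵀ i) + B (Wᵀ j) (Wᵀ j)) * hcs
      have := NTC.ent_schur h2 (by linarith) (by linarith) hsum
      linarith
    · intro k hk
      rw [r3 k hk.1 hk.2, sub_self]
  have horth : ∀ i j, i ≠ j → B (Wᵀ i) (Wᵀ j) = 0 := by
    intro i j hij
    rcases le_total (B (Wᵀ j) (Wᵀ j)) (B (Wᵀ i) (Wᵀ i)) with h | h
    · exact step1 i j hij h
    · rw [hBs]; exact step1 j i hij.symm h
  -- step 2: reduced objective
  have hred : ∀ V : Matrix (Fin d) (Fin d) ℝ, (∀ i j, i ≠ j → B (Vᵀ i) (Vᵀ j) = 0) →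
      F V = trace K + ∑ k, NTC.cost B Q lam (Vᵀ k) := by
    intro V hV
    have hg := NTC.gain_diag K V hK (fun i j hij => by rw [hgram]; exact hV i j hij)
    unfold NTC.gain at hg
    rw [hF, hg]
    simp_rw [hgram, ← hQ]
    unfold NTC.cost
    rw [Finset.sum_add_distrib, Finset.sum_neg_distrib, ← Finset.mul_sum]
    ring
  have hopt : ∀ w' : Fin d → (Fin d → ℝ), (∀ i j, i ≠ j → B (w' i) (w' j) = 0) →
      ∑ k, NTC.cost B Q lam (Wᵀ k) ≤ ∑ k, NTC.cost B Q lam (w' k) := by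
    intro w' hw'
    have h := hW_opt (Matrix.of w')ᵀ
    rw [hred W horth, hred (Matrix.of w')ᵀ hw'] at h
    exact (add_le_add_iff_left _).1 h
  intro j hj
  have hj' : Wᵀ j ≠ 0 := hj
  have hcols := NTC.core_pair B Q lam hlam hBs hQs hBp (fun k => Wᵀ k) horth hopt
  have hort := NTC.core_orth B Q lam hBs hQs hBp (fun k => Wᵀ k) horth hopt j hj'
  have hBK : ∀ x y, B (K *ᵥ x) y = Q x y := by
    intro x y
    rw [hB, hQ, ← mulVec_mulVec, dotProduct_mulVec x K, ← mulVec_transpose, hKt]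
  have hs := hBp _ hj'
  set μ := Q (Wᵀ j) (Wᵀ j) / B (Wᵀ j) (Wᵀ j) with hμ
  refine ⟨μ, ?_⟩
  change K *ᵥ (Wᵀ j) = μ • Wᵀ j
  set v := K *ᵥ (Wᵀ j) - μ • Wᵀ j with hv
  have e : ∀ y, B v y = Q (Wᵀ j) y - μ * B (Wᵀ j) y := by
    intro y
    rw [hv, map_sub, LinearMap.sub_apply, hBK, map_smul, LinearMap.smul_apply, smul_eq_mul]
  have hvo : ∀ k, B v (Wᵀ k) = 0 := by
    intro k
    rw [e]
    by_cases hkj : k = j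
    · subst hkj
      rw [hμ]; field_simp; ring
    · rw [horth j k (Ne.symm hkj), mul_zero, sub_zero]
      by_cases hk0 : Wᵀ k = 0
      · simp [hk0]
      · exact hcols j k (Ne.symm hkj) hj' hk0
  have h1 : Q (Wᵀ j) v = 0 := hort v hvo
  have hvv : B v v = 0 := by
    rw [e, h1, hBs, hvo j]; ring
  have hv0 : v = 0 := by
    by_contra h
    exact (hBp v h).ne' hvv
  exact sub_eq_zero.1 hv0
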